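/- Let Σ_Λ = {Σ_λ = (γ_λ,f_λ,g_λ)}_{λ∈Λ} and h⁰, h ∈ H satisfy Assumption 1 with φ_λ(t,r) = p_λ(t)·r, where each p_λ : [0,∞) → R is Lebesgue measurable and locally integrable, and with α_λ(t,r) = d·r for a constant d ≥ 0. Suppose there exist κ > 0 and c ∈ R such that for all λ ∈ Λ every solution of the linear equation ẇ = −p_λ(t)w satisfies |w(t)| ≤ κ e^{−c(t−t_0)} |w(t_0)| for all t ≥ t_0 ≥ 0. If there exist η, μ > 0 such that for every γ ∈ Γ_Λ = {γ_λ : λ ∈ Λ}, n^γ_{(t_0,t]} [ln(d) + η] − (c−η)(t−t_0) ≤ μ for all t ≥ t_0 ≥ 0 (with the conventions 0·ln(0) = 0 and r·ln(0) = −∞ for r > 0), then Σ_Λ is strongly (h⁰,h)-ISS. -/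

import Mathlib

open MeasureTheory Filter Set
open scoped Classical

noncomputable section

/-- State/input spaces: `ℝ^k` with the Euclidean norm. -/
abbrev Stt (k : ℕ) : Type := EuclideanSpace ℝ (Fin k)

/-- An impulse-time sequence, identified with its (locally finite) set of impulse
times, a subset of `(0,∞)` with finitely many points below any bound. -/
def IsImpulseSeq (γ : Set ℝ) : Prop :=
  γ ⊆ Set.Ioi (0 : ℝ) ∧ ∀ T : ℝ, (γ ∩ Set.Iic T).Finite

/-- `n^γ_{(s,t]}`: the number of impulse times in the interval `(s,t]`. -/
def nJumps (γ : Set ℝ) (s t : ℝ) : ℕ := (γ ∩ Set.Ioc s t).ncard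

/-- Uniform incremental boundedness of a set of impulse-time sequences. -/
def UIB (S : Set (Set ℝ)) : Prop :=
  ∃ φ : ℝ → ℝ, ContinuousOn φ (Set.Ici 0) ∧ MonotoneOn φ (Set.Ici 0) ∧
    (∀ s : ℝ, 0 ≤ s → 0 ≤ φ s) ∧
    ∀ γ ∈ S, ∀ t0 t : ℝ, 0 ≤ t0 → t0 < t → (nJumps γ t0 t : ℝ) ≤ φ (t - t0)

/-- Class `K∞` functions `[0,∞) → [0,∞)`. -/
def ClassKInf (α : ℝ → ℝ) : Prop :=
  ContinuousOn α (Set.Ici 0) ∧ StrictMonoOn α (Set.Ici 0) ∧ α 0 = 0 ∧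
    ∀ M : ℝ, ∃ r : ℝ, 0 ≤ r ∧ M ≤ α r

/-- Class `KL` functions. -/
def ClassKL (β : ℝ → ℝ → ℝ) : Prop :=
  (∀ t : ℝ, 0 ≤ t → ClassKInf fun r => β r t) ∧
  ∀ r : ℝ, 0 ≤ r → AntitoneOn (fun t => β r t) (Set.Ici 0) ∧
    Filter.Tendsto (fun t => β r t) Filter.atTop (nhds 0)

/-- Positive definite functions `[0,∞) → [0,∞)`. -/
def PosDef (ρ : ℝ → ℝ) : Prop :=
  ContinuousOn ρ (Set.Ici 0) ∧ ρ 0 = 0 ∧ ∀ r : ℝ, 0 < r → 0 < ρ r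

/-- Locally integrable (on compacts) function `[0,∞) → ℝ` (extended to `ℝ`). -/
def LocIntegrable (p : ℝ → ℝ) : Prop :=
  ∀ a b : ℝ, MeasureTheory.IntegrableOn p (Set.Icc a b)

/-- Inputs: measurable, locally essentially bounded functions. -/
def IsInput {m : ℕ} (u : ℝ → Stt m) : Prop :=
  Measurable u ∧ ∀ T : ℝ, ∃ C : ℝ, ∀ᵐ t ∂MeasureTheory.volume, t ∈ Set.Icc 0 T → ‖u t‖ ≤ C

/-- `‖u_I‖_γ`: max of the essential supremum of `‖u‖` over `I` and the supremum of
`‖u‖` over `γ ∩ I`. -/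
def inputNorm {m : ℕ} (γ : Set ℝ) (u : ℝ → Stt m) (I : Set ℝ) : ℝ :=
  max (essSup (fun t => ‖u t‖) (MeasureTheory.volume.restrict I))
      (sSup ((fun t => ‖u t‖) '' (γ ∩ I)))

/-- Solution of the impulsive system `(γ,f,g)` on `[t0,T)` with initial state `x0`
and input `u` (Carathéodory solutions, in integral form, between impulses). -/
structure IsSolution {n m : ℕ} (γ : Set ℝ) (f g : ℝ → Stt n → Stt m → Stt n)
    (t0 : ℝ) (x0 : Stt n) (u : ℝ → Stt m) (T : EReal) (x : ℝ → Stt n) : Prop where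
  lt : (t0 : EReal) < T
  init : x t0 = x0
  flow : ∀ t1 t2 : ℝ, t0 ≤ t1 → t1 ≤ t2 → (t2 : EReal) < T → Set.Ioc t1 t2 ∩ γ = ∅ →
    MeasureTheory.IntegrableOn (fun s => f s (x s) (u s)) (Set.Icc t1 t2) ∧
    x t2 = x t1 + ∫ s in t1..t2, f s (x s) (u s)
  jump : ∀ t ∈ γ, t0 < t → (t : EReal) < T →
    ∃ L : Stt n, Filter.Tendsto x (nhdsWithin t (Set.Iio t)) (nhds L) ∧
      x t = L + g t L (u t)

/-- Maximally defined solution. -/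
def IsMaxSolution {n m : ℕ} (γ : Set ℝ) (f g : ℝ → Stt n → Stt m → Stt n)
    (t0 : ℝ) (x0 : Stt n) (u : ℝ → Stt m) (T : EReal) (x : ℝ → Stt n) : Prop :=
  IsSolution γ f g t0 x0 u T x ∧
    ∀ (T' : EReal) (x' : ℝ → Stt n), IsSolution γ f g t0 x0 u T' x' →
      (∀ t : ℝ, t0 ≤ t → (t : EReal) < T → x' t = x t) → T' ≤ T

/-- Weak `(h⁰,h)`-ISS of a parametrized family of impulsive systems. -/
def WeaklyISS {n m : ℕ} {Λ : Type*} (γ : Λ → Set ℝ)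
    (f g : Λ → ℝ → Stt n → Stt m → Stt n) (h0 h : ℝ → Stt n → ℝ) : Prop :=
  ∃ β : ℝ → ℝ → ℝ, ∃ ρ : ℝ → ℝ, ClassKL β ∧ ClassKInf ρ ∧
    ∀ (l : Λ) (t0 : ℝ) (x0 : Stt n) (u : ℝ → Stt m) (T : EReal) (x : ℝ → Stt n),
      0 ≤ t0 → IsInput u → IsMaxSolution (γ l) (f l) (g l) t0 x0 u T x →
      ∀ t : ℝ, t0 ≤ t → (t : EReal) < T →
        h t (x t) ≤ β (h0 t0 x0) (t - t0) + ρ (inputNorm (γ l) u (Set.Ioc t0 t))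

/-- Strong `(h⁰,h)`-ISS of a parametrized family of impulsive systems. -/
def StronglyISS {n m : ℕ} {Λ : Type*} (γ : Λ → Set ℝ)
    (f g : Λ → ℝ → Stt n → Stt m → Stt n) (h0 h : ℝ → Stt n → ℝ) : Prop :=
  ∃ β : ℝ → ℝ → ℝ, ∃ ρ : ℝ → ℝ, ClassKL β ∧ ClassKInf ρ ∧
    ∀ (l : Λ) (t0 : ℝ) (x0 : Stt n) (u : ℝ → Stt m) (T : EReal) (x : ℝ → Stt n),
      0 ≤ t0 → IsInput u → IsMaxSolution (γ l) (f l) (g l) t0 x0 u T x →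
      ∀ t : ℝ, t0 ≤ t → (t : EReal) < T →
        h t (x t) ≤ β (h0 t0 x0) (t - t0 + (nJumps (γ l) t0 t : ℝ)) +
          ρ (inputNorm (γ l) u (Set.Ioc t0 t))

/-- Locally Lipschitz on a set. -/
def LocLipschitzOn {α β : Type*} [PseudoEMetricSpace α] [PseudoEMetricSpace β]
    (s : Set α) (f : α → β) : Prop :=
  ∀ x ∈ s, ∃ K : NNReal, ∃ t ∈ nhdsWithin x s, LipschitzOnWith K f t

/-- `V ∈ V(γ)` with `Vm` its left-limit function at impulse times: `V` is locally
Lipschitz on each inter-impulse strip and has the joint left limit `Vm τ ξ`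
at each `τ ∈ γ`. -/
def InClassV {n : ℕ} (γ : Set ℝ) (V Vm : ℝ → Stt n → ℝ) : Prop :=
  (∀ a b : ℝ, 0 ≤ a → Set.Ioo a b ∩ γ = ∅ →
    LocLipschitzOn (Set.Ico a b ×ˢ (Set.univ : Set (Stt n)))
      (fun q : ℝ × Stt n => V q.1 q.2)) ∧
  ∀ τ ∈ γ, ∀ ξ : Stt n,
    Filter.Tendsto (fun q : ℝ × Stt n => V q.1 q.2)
      (nhdsWithin (τ, ξ) (Set.Iio τ ×ˢ (Set.univ : Set (Stt n)))) (nhds (Vm τ ξ))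

/-- Upper-right Dini derivative of `V` along the flow map `f`. -/
def DiniAlong {n m : ℕ} (f : ℝ → Stt n → Stt m → Stt n) (V : ℝ → Stt n → ℝ)
    (t : ℝ) (ξ : Stt n) (μ : Stt m) : ℝ :=
  Filter.limsup (fun d : ℝ => (V (t + d) (ξ + d • f t ξ μ) - V t ξ) / d)
    (nhdsWithin 0 (Set.Ioi 0))

/-- Carathéodory function `[0,∞) × [0,∞) → ℝ`. -/
def Caratheodory2 (φ : ℝ → ℝ → ℝ) : Prop :=
  (∀ r : ℝ, Measurable fun t => φ t r) ∧
  (∀ t : ℝ, ContinuousOn (φ t) (Set.Ici 0)) ∧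
  ∀ a b c : ℝ, ∃ mK : ℝ → ℝ, MeasureTheory.IntegrableOn mK (Set.Icc a b) ∧
    ∀ t ∈ Set.Icc a b, ∀ r ∈ Set.Icc (0 : ℝ) c, |φ t r| ≤ mK t

/-- Assumption 1 of the paper, with all the data explicit. -/
def Assumption1 {n m : ℕ} {Λ : Type*} (γ : Λ → Set ℝ)
    (f g : Λ → ℝ → Stt n → Stt m → Stt n) (h0 h : ℝ → Stt n → ℝ)
    (V Vm : Λ → ℝ → Stt n → ℝ) (φ1 φ2 χ π : ℝ → ℝ)
    (vφ al : Λ → ℝ → ℝ → ℝ) : Prop :=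
  ClassKInf φ1 ∧ ClassKInf φ2 ∧ ClassKInf χ ∧ ClassKInf π ∧
  (∀ l : Λ, InClassV (γ l) (V l) (Vm l)) ∧
  (∀ l : Λ, Caratheodory2 (vφ l)) ∧
  (∀ (l : Λ) (t r : ℝ), 0 ≤ t → 0 ≤ r → 0 ≤ al l t r) ∧
  (∀ (l : Λ) (t : ℝ) (ξ : Stt n), 0 ≤ t →
    φ1 (h t ξ) ≤ V l t ξ ∧ V l t ξ ≤ φ2 (h0 t ξ)) ∧
  (∀ (l : Λ) (t : ℝ) (ξ : Stt n) (μ : Stt m), 0 ≤ t → t ∉ γ l → χ ‖μ‖ ≤ V l t ξ →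
    DiniAlong (f l) (V l) t ξ μ ≤ - vφ l t (V l t ξ)) ∧
  (∀ (l : Λ) (t : ℝ) (ξ : Stt n) (μ : Stt m), t ∈ γ l → χ ‖μ‖ ≤ Vm l t ξ →
    V l t (ξ + g l t ξ μ) ≤ al l t (Vm l t ξ)) ∧
  (∀ (l : Λ) (t : ℝ) (ξ : Stt n) (μ : Stt m), t ∈ γ l → Vm l t ξ ≤ χ ‖μ‖ →
    V l t (ξ + g l t ξ μ) ≤ π ‖μ‖)

/-- Solution of the scalar comparison differential/difference inclusion. -/
structure IsCompSol (γ : Set ℝ) (vφ al : ℝ → ℝ → ℝ) (t0 z0 : ℝ) (T : EReal)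
    (z : ℝ → ℝ) : Prop where
  lt : (t0 : EReal) < T
  init : z t0 = z0
  nonneg : ∀ t : ℝ, t0 ≤ t → (t : EReal) < T → 0 ≤ z t
  flow : ∀ t1 t2 : ℝ, t0 ≤ t1 → t1 ≤ t2 → (t2 : EReal) < T → Set.Ioc t1 t2 ∩ γ = ∅ →
    ∃ d : ℝ → ℝ, MeasureTheory.IntegrableOn d (Set.Icc t1 t2) ∧
      (∀ᵐ s ∂MeasureTheory.volume, s ∈ Set.Icc t1 t2 → d s ≤ - vφ s (z s)) ∧
      ∀ t ∈ Set.Icc t1 t2, z t = z t1 + ∫ s in t1..t, d s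
  jump : ∀ t ∈ γ, t0 < t → (t : EReal) < T →
    ∃ L : ℝ, Filter.Tendsto z (nhdsWithin t (Set.Iio t)) (nhds L) ∧ z t ≤ al t L

/-- The family of comparison systems is weakly GUAS. -/
def CompWeakGUAS {Λ : Type*} (γ : Λ → Set ℝ) (vφ al : Λ → ℝ → ℝ → ℝ) : Prop :=
  ∃ β : ℝ → ℝ → ℝ, ClassKL β ∧
    ∀ (l : Λ) (t0 z0 : ℝ) (T : EReal) (z : ℝ → ℝ), 0 ≤ t0 → 0 ≤ z0 →
      IsCompSol (γ l) (vφ l) (al l) t0 z0 T z →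
      ∀ t : ℝ, t0 ≤ t → (t : EReal) < T → z t ≤ β z0 (t - t0)

/-- The family of comparison systems is strongly GUAS. -/
def CompStrongGUAS {Λ : Type*} (γ : Λ → Set ℝ) (vφ al : Λ → ℝ → ℝ → ℝ) : Prop :=
  ∃ β : ℝ → ℝ → ℝ, ClassKL β ∧
    ∀ (l : Λ) (t0 z0 : ℝ) (T : EReal) (z : ℝ → ℝ), 0 ≤ t0 → 0 ≤ z0 →
      IsCompSol (γ l) (vφ l) (al l) t0 z0 T z →
      ∀ t : ℝ, t0 ≤ t → (t : EReal) < T → z t ≤ β z0 (t - t0 + (nJumps (γ l) t0 t : ℝ))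

/-- Nonnegative Carathéodory solution of the scalar ODE `ẇ = rhs(t,w)` on `[t0,T)`. -/
structure IsODESol (rhs : ℝ → ℝ → ℝ) (t0 : ℝ) (T : EReal) (w : ℝ → ℝ) : Prop where
  lt : (t0 : EReal) < T
  nonneg : ∀ t : ℝ, t0 ≤ t → (t : EReal) < T → 0 ≤ w t
  flow : ∀ t1 t2 : ℝ, t0 ≤ t1 → t1 ≤ t2 → (t2 : EReal) < T →
    IntervalIntegrable (fun s => rhs s (w s)) MeasureTheory.volume t1 t2 ∧
    w t2 = w t1 + ∫ s in t1..t2, rhs s (w s)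

/-- Maximally defined forward-in-time solution of `ẇ = rhs(t,w)`. -/
def IsMaxODESol (rhs : ℝ → ℝ → ℝ) (t0 : ℝ) (T : EReal) (w : ℝ → ℝ) : Prop :=
  IsODESol rhs t0 T w ∧
    ∀ (T' : EReal) (w' : ℝ → ℝ), IsODESol rhs t0 T' w' →
      (∀ t : ℝ, t0 ≤ t → (t : EReal) < T → w' t = w t) → T' ≤ T

/-- GUAS of the family of scalar ODEs `ẇ = −φ_λ(t,w)`. -/
def ODEFamilyGUAS {Λ : Type*} (vφ : Λ → ℝ → ℝ → ℝ) : Prop :=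
  ∃ β : ℝ → ℝ → ℝ, ClassKL β ∧
    ∀ (l : Λ) (t0 : ℝ) (T : EReal) (w : ℝ → ℝ), 0 ≤ t0 →
      IsMaxODESol (fun s r => -(vφ l s r)) t0 T w →
      T = (⊤ : EReal) ∧ ∀ t : ℝ, t0 ≤ t → w t ≤ β (w t0) (t - t0)

/-- Solution (on all of `[0,∞)`) of the scalar linear ODE `ẇ = −p(t)·w`. -/
def IsLinSol (p : ℝ → ℝ) (w : ℝ → ℝ) : Prop :=
  ∀ t1 t2 : ℝ, 0 ≤ t1 → t1 ≤ t2 →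
    IntervalIntegrable (fun s => p s * w s) MeasureTheory.volume t1 t2 ∧
    w t2 = w t1 + ∫ s in t1..t2, -(p s * w s)

/-- An impulsive and switching sequence, described through its impulse-time set,
its two switching signals (constant between impulses), and the left limit of the
first switching signal at impulse times. -/
structure SwSignal (Ic Id : Type*) where
  γ : Set ℝ
  σ1 : ℝ → Ic
  σ1m : ℝ → Ic
  σ2 : ℝ → Id
  impulse : IsImpulseSeq γ
  const1 : ∀ a b : ℝ, 0 ≤ a → Set.Ioo a b ∩ γ = ∅ → ∀ t ∈ Set.Ico a b, σ1 t = σ1 a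
  const2 : ∀ a b : ℝ, 0 ≤ a → Set.Ioo a b ∩ γ = ∅ → ∀ t ∈ Set.Ico a b, σ2 t = σ2 a
  leftlim : ∀ t ∈ γ, ∀ᶠ s in nhdsWithin t (Set.Iio t), σ1 s = σ1m t

/-- `σ ∈ SW(J)`. -/
def InSW {Ic Id : Type*} (σ : SwSignal Ic Id) (J : Set (Ic × Ic × Id)) : Prop :=
  ∀ t ∈ σ.γ, (σ.σ1m t, σ.σ1 t, σ.σ2 t) ∈ J

/-- Flow map of the switched impulsive system `Σ_σ`. -/
def swF {n m : ℕ} {Ic Id : Type*} (F : Ic → ℝ → Stt n → Stt m → Stt n)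
    (σ : SwSignal Ic Id) : ℝ → Stt n → Stt m → Stt n :=
  fun t ξ μ => F (σ.σ1 t) t ξ μ

/-- Jump map of the switched impulsive system `Σ_σ`. -/
def swG {n m : ℕ} {Ic Id : Type*} (G : Id → ℝ → Stt n → Stt m → Stt n)
    (σ : SwSignal Ic Id) : ℝ → Stt n → Stt m → Stt n :=
  fun t ξ μ => G (σ.σ2 t) t ξ μ

/-- Weak `(h⁰,h)`-ISS of the family `{Σ_σ}_{σ ∈ SW}`. -/
def SwWeaklyISS {n m : ℕ} {Ic Id : Type*} (F : Ic → ℝ → Stt n → Stt m → Stt n)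
    (G : Id → ℝ → Stt n → Stt m → Stt n) (SW : Set (SwSignal Ic Id))
    (h0 h : ℝ → Stt n → ℝ) : Prop :=
  ∃ β : ℝ → ℝ → ℝ, ∃ ρ : ℝ → ℝ, ClassKL β ∧ ClassKInf ρ ∧
    ∀ σ ∈ SW, ∀ (t0 : ℝ) (x0 : Stt n) (u : ℝ → Stt m) (T : EReal) (x : ℝ → Stt n),
      0 ≤ t0 → IsInput u → IsMaxSolution σ.γ (swF F σ) (swG G σ) t0 x0 u T x →
      ∀ t : ℝ, t0 ≤ t → (t : EReal) < T →
        h t (x t) ≤ β (h0 t0 x0) (t - t0) + ρ (inputNorm σ.γ u (Set.Ioc t0 t))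

/-- Strong `(h⁰,h)`-ISS of the family `{Σ_σ}_{σ ∈ SW}`. -/
def SwStronglyISS {n m : ℕ} {Ic Id : Type*} (F : Ic → ℝ → Stt n → Stt m → Stt n)
    (G : Id → ℝ → Stt n → Stt m → Stt n) (SW : Set (SwSignal Ic Id))
    (h0 h : ℝ → Stt n → ℝ) : Prop :=
  ∃ β : ℝ → ℝ → ℝ, ∃ ρ : ℝ → ℝ, ClassKL β ∧ ClassKInf ρ ∧
    ∀ σ ∈ SW, ∀ (t0 : ℝ) (x0 : Stt n) (u : ℝ → Stt m) (T : EReal) (x : ℝ → Stt n),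
      0 ≤ t0 → IsInput u → IsMaxSolution σ.γ (swF F σ) (swG G σ) t0 x0 u T x →
      ∀ t : ℝ, t0 ≤ t → (t : EReal) < T →
        h t (x t) ≤ β (h0 t0 x0) (t - t0 + (nJumps σ.γ t0 t : ℝ)) +
          ρ (inputNorm σ.γ u (Set.Ioc t0 t))

/-- Total activation time in `(t0,t]` of the flow modes in `A`. -/
def actT {Ic Id : Type*} (σ : SwSignal Ic Id) (A : Set Ic) (t0 t : ℝ) : ℝ :=
  (MeasureTheory.volume {r : ℝ | r ∈ Set.Ioc t0 t ∧ σ.σ1 r ∈ A}).toReal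

/-- Number of impulse times in `(t0,t]` whose mode combination lies in `Jp`. -/
def nJumpsIn {Ic Id : Type*} (σ : SwSignal Ic Id) (Jp : Set (Ic × Ic × Id))
    (t0 t : ℝ) : ℕ :=
  (σ.γ ∩ Set.Ioc t0 t ∩ {r : ℝ | (σ.σ1m r, σ.σ1 r, σ.σ2 r) ∈ Jp}).ncard

/-- Assumption 2 of the paper (for switched impulsive systems), data explicit. -/
def Assumption2 {n m : ℕ} {Ic Id : Type*}
    (F : Ic → ℝ → Stt n → Stt m → Stt n) (G : Id → ℝ → Stt n → Stt m → Stt n)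
    (h0 h : ℝ → Stt n → ℝ) (J : Set (Ic × Ic × Id))
    (v : Ic → ℝ → Stt n → ℝ) (φ1 φ2 χ π : ℝ → ℝ)
    (vφ : Ic → ℝ → ℝ → ℝ) (al : Ic × Ic × Id → ℝ → ℝ → ℝ) : Prop :=
  ClassKInf φ1 ∧ ClassKInf φ2 ∧ ClassKInf χ ∧ ClassKInf π ∧
  (∀ i : Ic, LocLipschitzOn ((Set.Ici (0 : ℝ)) ×ˢ (Set.univ : Set (Stt n)))
      (fun q : ℝ × Stt n => v i q.1 q.2)) ∧
  (∀ i : Ic, Caratheodory2 (vφ i)) ∧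
  (∀ e ∈ J, ∀ t r : ℝ, 0 ≤ t → 0 ≤ r → 0 ≤ al e t r) ∧
  (∀ (i : Ic) (t : ℝ) (ξ : Stt n), 0 ≤ t →
    φ1 (h t ξ) ≤ v i t ξ ∧ v i t ξ ≤ φ2 (h0 t ξ)) ∧
  (∀ (i : Ic) (t : ℝ) (ξ : Stt n) (μ : Stt m), 0 ≤ t → χ ‖μ‖ ≤ v i t ξ →
    DiniAlong (F i) (v i) t ξ μ ≤ - vφ i t (v i t ξ)) ∧
  (∀ (ι i : Ic) (j : Id), (ι, i, j) ∈ J → ∀ (t : ℝ) (ξ : Stt n) (μ : Stt m),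
    0 ≤ t → χ ‖μ‖ ≤ v ι t ξ → v i t (ξ + G j t ξ μ) ≤ al (ι, i, j) t (v ι t ξ)) ∧
  (∀ (ι i : Ic) (j : Id), (ι, i, j) ∈ J → ∀ (t : ℝ) (ξ : Stt n) (μ : Stt m),
    0 ≤ t → v ι t ξ ≤ χ ‖μ‖ → v i t (ξ + G j t ξ μ) ≤ π ‖μ‖)

theorem ClassKInf.nonneg {α : ℝ → ℝ} (hα : ClassKInf α) {r : ℝ} (hr : 0 ≤ r) : 0 ≤ α r := by
  have := hα.2.1.monotoneOn (mem_Ici.2 le_rfl) (mem_Ici.2 hr) hr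
  rwa [hα.2.2.1] at this

theorem ClassKInf.mono {α : ℝ → ℝ} (hα : ClassKInf α) {r s : ℝ} (hr : 0 ≤ r) (hrs : r ≤ s) :
    α r ≤ α s :=
  hα.2.1.monotoneOn (mem_Ici.2 hr) (mem_Ici.2 (hr.trans hrs)) hrs

theorem ClassKInf.mapsTo {α : ℝ → ℝ} (hα : ClassKInf α) : MapsTo α (Ici 0) (Ici 0) :=
  fun _ hr => hα.nonneg hr

theorem ClassKInf.comp {α β : ℝ → ℝ} (hα : ClassKInf α) (hβ : ClassKInf β) :
    ClassKInf fun r => α (β r) := by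
  refine ⟨hα.1.comp hβ.1 hβ.mapsTo, hα.2.1.comp hβ.2.1 hβ.mapsTo, ?_, fun M => ?_⟩
  · simp [hβ.2.2.1, hα.2.2.1]
  · obtain ⟨s, hs, hsM⟩ := hα.2.2.2 M
    obtain ⟨r, hr, hrs⟩ := hβ.2.2.2 s
    exact ⟨r, hr, hsM.trans (hα.mono hs hrs)⟩

theorem ClassKInf.add {α β : ℝ → ℝ} (hα : ClassKInf α) (hβ : ClassKInf β) :
    ClassKInf fun r => α r + β r := by
  refine ⟨hα.1.add hβ.1, hα.2.1.add hβ.2.1, by simp [hα.2.2.1, hβ.2.2.1], fun M => ?_⟩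
  obtain ⟨r, hr, hrM⟩ := hα.2.2.2 M
  exact ⟨r, hr, by linarith [hβ.nonneg hr]⟩

theorem ClassKInf.const_mul {α : ℝ → ℝ} (hα : ClassKInf α) {C : ℝ} (hC : 0 < C) :
    ClassKInf fun r => C * α r := by
  refine ⟨hα.1.const_smul C, fun a ha b hb hab => mul_lt_mul_of_pos_left (hα.2.1 ha hb hab) hC,
    by simp [hα.2.2.1], fun M => ?_⟩
  obtain ⟨r, hr, hrM⟩ := hα.2.2.2 (M / C)
  exact ⟨r, hr, by rwa [div_le_iff₀' hC] at hrM⟩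

theorem ClassKInf.surjOn {α : ℝ → ℝ} (hα : ClassKInf α) : SurjOn α (Ici 0) (Ici 0) := by
  intro y hy
  obtain ⟨r, hr, hyr⟩ := hα.2.2.2 y
  have h := intermediate_value_Icc hr (hα.1.mono Icc_subset_Ici_self)
  rw [hα.2.2.1] at h
  obtain ⟨x, hx, rfl⟩ := h ⟨hy, hyr⟩
  exact ⟨x, hx.1, rfl⟩

theorem ClassKInf.exists_leftInverse {α : ℝ → ℝ} (hα : ClassKInf α) :
    ∃ ψ : ℝ → ℝ, ClassKInf ψ ∧ ∀ r, 0 ≤ r → ψ (α r) = r := by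
  have himg : α '' Ici 0 = Ici 0 := hα.surjOn.image_eq_of_mapsTo hα.mapsTo
  let e : Ici (0 : ℝ) ≃o Ici (0 : ℝ) :=
    (hα.2.1.orderIso α (Ici 0)).trans (OrderIso.setCongr _ _ himg)
  have he : ∀ r : Ici (0 : ℝ), (e r : ℝ) = α r := fun r => rfl
  let ψ : ℝ → ℝ := fun y => if hy : 0 ≤ y then (e.symm ⟨y, hy⟩ : ℝ) else 0
  have hψ : ∀ y : Ici (0 : ℝ), ψ y = e.symm y := fun y => by
    have : (0 : ℝ) ≤ y := y.2
    simp [ψ, this]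
  have hinv : ∀ r, 0 ≤ r → ψ (α r) = r := fun r hr => by
    have h := hψ (e ⟨r, hr⟩)
    rwa [he, e.symm_apply_apply] at h
  refine ⟨ψ, ⟨?_, ?_, ?_, fun M => ?_⟩, hinv⟩
  · rw [continuousOn_iff_continuous_domRestrict]
    have : (Ici (0 : ℝ)).domRestrict ψ = fun y => (e.symm y : ℝ) := funext hψ
    rw [this]
    exact continuous_subtype_val.comp e.symm.continuous
  · intro a ha b hb hab
    have := e.symm.strictMono (show (⟨a, ha⟩ : Ici (0 : ℝ)) < ⟨b, hb⟩ from hab)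
    have h1 := hψ ⟨a, ha⟩
    have h2 := hψ ⟨b, hb⟩
    simp only at h1 h2
    rw [h1, h2]
    exact this
  · have := hinv 0 le_rfl
    rwa [hα.2.2.1] at this
  · refine ⟨α (max M 0), hα.nonneg (le_max_right _ _), ?_⟩
    rw [hinv _ (le_max_right _ _)]
    exact le_max_left _ _

theorem ClassKInf.apply_add_le {ψ : ℝ → ℝ} (hψ : ClassKInf ψ) {a b : ℝ} (ha : 0 ≤ a)
    (hb : 0 ≤ b) : ψ (a + b) ≤ ψ (2 * a) + ψ (2 * b) := by
  have ha' := hψ.nonneg (mul_nonneg zero_le_two ha)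
  have hb' := hψ.nonneg (mul_nonneg zero_le_two hb)
  rcases le_total a b with h | h
  · linarith [hψ.mono (add_nonneg ha hb) (show a + b ≤ 2 * b by linarith)]
  · linarith [hψ.mono (add_nonneg ha hb) (show a + b ≤ 2 * a by linarith)]

theorem classKL_exp_decay {ψ φ : ℝ → ℝ} (hψ : ClassKInf ψ) (hφ : ClassKInf φ) {C η : ℝ}
    (hC : 0 < C) (hη : 0 < η) :
    ClassKL fun r t => ψ (C * Real.exp (-(η * t)) * φ r) := by
  refine ⟨fun t _ => hψ.comp (hφ.const_mul (by positivity)), fun r hr => ⟨?_, ?_⟩⟩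
  · intro s _ t _ hst
    have := hφ.nonneg hr
    refine hψ.mono (by positivity) ?_
    gcongr
  · have h1 : Tendsto (fun t => C * Real.exp (-(η * t)) * φ r) atTop (nhds 0) := by
      have : Tendsto (fun t : ℝ => Real.exp (-(η * t))) atTop (nhds 0) :=
        Real.tendsto_exp_neg_atTop_nhds_zero.comp (tendsto_id.const_mul_atTop hη)
      simpa using (this.const_mul C).mul_const (φ r)
    have h2 : Tendsto (fun t => C * Real.exp (-(η * t)) * φ r) atTop (nhdsWithin 0 (Ici 0)) :=
      tendsto_nhdsWithin_iff.2 ⟨h1, Eventually.of_forall fun t => by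
        have := hφ.nonneg hr
        exact mem_Ici.2 (by positivity)⟩
    have h3 := (hψ.1 0 (mem_Ici.2 le_rfl)).tendsto.comp h2
    rwa [hψ.2.2.1] at h3

theorem IsImpulseSeq.finite_inter_Ioc {γ : Set ℝ} (hγ : IsImpulseSeq γ) (a b : ℝ) :
    (γ ∩ Ioc a b).Finite :=
  (hγ.2 b).subset (inter_subset_inter_right _ Ioc_subset_Iic_self)

theorem IsImpulseSeq.nJumps_add {γ : Set ℝ} (hγ : IsImpulseSeq γ) {a b c : ℝ} (hab : a ≤ b)
    (hbc : b ≤ c) : nJumps γ a c = nJumps γ a b + nJumps γ b c := by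
  unfold nJumps
  rw [← ncard_union_eq _ (hγ.finite_inter_Ioc a b) (hγ.finite_inter_Ioc b c),
    ← inter_union_distrib_left, Ioc_union_Ioc_eq_Ioc hab hbc]
  exact (Ioc_disjoint_Ioc_of_le le_rfl).mono inter_subset_right inter_subset_right

theorem IsImpulseSeq.exists_isolating {γ : Set ℝ} (hγ : IsImpulseSeq γ) (τ : ℝ) :
    ∃ ε > 0, ∀ s ∈ γ, |s - τ| < ε → s = τ := by
  have hfin : ((γ ∩ Iic (τ + 1)) \ {τ}).Finite := (hγ.2 (τ + 1)).sdiff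
  have hmem : ((γ ∩ Iic (τ + 1)) \ {τ})ᶜ ∈ nhds τ :=
    hfin.isClosed.isOpen_compl.mem_nhds (by simp)
  obtain ⟨ε, hε, hball⟩ := Metric.mem_nhds_iff.1 hmem
  refine ⟨min ε 1, by positivity, fun s hs hsτ => ?_⟩
  by_contra hne
  refine hball (Metric.mem_ball.2 ?_) ⟨⟨hs, ?_⟩, hne⟩
  · rw [Real.dist_eq]
    exact hsτ.trans_le (min_le_left _ _)
  · have := (abs_lt.1 (hsτ.trans_le (min_le_right _ _))).2
    exact mem_Iic.2 (by linarith)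

theorem IsImpulseSeq.exists_last {γ : Set ℝ} (hγ : IsImpulseSeq γ) {a b : ℝ}
    (h : nJumps γ a b ≠ 0) : ∃ τ ∈ γ, τ ∈ Ioc a b ∧ Ioc τ b ∩ γ = ∅ := by
  have hne : (γ ∩ Ioc a b).Nonempty := nonempty_of_ncard_ne_zero h
  obtain ⟨τ, hτ⟩ := (hγ.finite_inter_Ioc a b).exists_maximal hne
  refine ⟨τ, hτ.1.1, hτ.1.2, ?_⟩
  by_contra hcon
  obtain ⟨s, hs, hsγ⟩ := nonempty_iff_ne_empty.2 hcon
  have := hτ.2 ⟨hsγ, hτ.1.2.1.trans hs.1, hs.2⟩ hs.1.le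
  exact absurd hs.1 (not_lt.2 this)

/-- Scalar estimate: above the level `R` a trajectory decays along flows by
`exp (-(P b - P a))` and is multiplied by at most `d` at impulses. -/
theorem le_transition_of_lt {γ : Set ℝ} (hγ : IsImpulseSeq γ) {v P : ℝ → ℝ} {a t d R : ℝ}
    (hd : 0 ≤ d) (hP : Continuous P)
    (hflow : ∀ r b, a ≤ r → r ≤ b → b ≤ t → Ioc r b ∩ γ = ∅ → (∀ s ∈ Ioc r b, R < v s) →
      v b ≤ Real.exp (-(P b - P r)) * v r)
    (hjump : ∀ τ ∈ γ, τ ∈ Ioc a t → ∃ L, Tendsto v (nhdsWithin τ (Iio τ)) (nhds L) ∧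
      (R ≤ L → v τ ≤ d * L))
    (habove : ∀ s ∈ Ioc a t, R < v s) (k : ℕ) :
    ∀ b ∈ Icc a t, nJumps γ a b = k → v b ≤ d ^ k * Real.exp (-(P b - P a)) * v a := by
  induction k with
  | zero =>
    intro b hb hk
    have hempty : Ioc a b ∩ γ = ∅ := by
      rw [inter_comm]
      exact (ncard_eq_zero (hγ.finite_inter_Ioc a b)).1 hk
    simpa using hflow a b le_rfl hb.1 hb.2 hempty fun s hs => habove s ⟨hs.1, hs.2.trans hb.2⟩
  | succ k ih =>
    intro b hb hk
    obtain ⟨τ, hτγ, hτ, hτb⟩ := hγ.exists_last (a := a) (b := b) (by omega)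
    obtain ⟨L, hL, hjL⟩ := hjump τ hτγ ⟨hτ.1, hτ.2.trans hb.2⟩
    obtain ⟨ε, hε, hiso⟩ := hγ.exists_isolating τ
    have hnear : ∀ᶠ s in nhdsWithin τ (Iio τ), s ∈ Ioo (max a (τ - ε)) τ :=
      Ioo_mem_nhdsLT (max_lt hτ.1 (by linarith))
    have hRL : R ≤ L := ge_of_tendsto hL (hnear.mono fun s hs =>
      (habove s ⟨(le_max_left _ _).trans_lt hs.1, (hs.2.le.trans hτ.2).trans hb.2⟩).le)
    have hbound : ∀ᶠ s in nhdsWithin τ (Iio τ),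
        v s ≤ d ^ k * Real.exp (-(P s - P a)) * v a := hnear.mono fun s hs => by
      have has : a < s := (le_max_left _ _).trans_lt hs.1
      have hτs : τ - ε < s := (le_max_right _ _).trans_lt hs.1
      refine ih s ⟨has.le, (hs.2.le.trans hτ.2).trans hb.2⟩ ?_
      have hone : γ ∩ Ioc s b = {τ} := by
        ext r
        constructor
        · rintro ⟨hrγ, hr⟩
          rcases le_or_gt r τ with hrτ | hrτ
          · exact hiso r hrγ (abs_lt.2 ⟨by linarith [hr.1], by linarith⟩)
          · exact absurd (show r ∈ Ioc τ b ∩ γ from ⟨⟨hrτ, hr.2⟩, hrγ⟩) (by simp [hτb])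
        · rintro rfl
          exact ⟨hτγ, hs.2, hτ.2⟩
      have hadd := hγ.nJumps_add has.le (hs.2.le.trans hτ.2)
      have h1 : nJumps γ s b = 1 := by
        unfold nJumps
        rw [hone, ncard_singleton]
      omega
    have hcont : Tendsto (fun s => d ^ k * Real.exp (-(P s - P a)) * v a)
        (nhdsWithin τ (Iio τ)) (nhds (d ^ k * Real.exp (-(P τ - P a)) * v a)) :=
      Continuous.tendsto' (by fun_prop) _ _ rfl |>.mono_left nhdsWithin_le_nhds
    have hLle := le_of_tendsto_of_tendsto hL hcont hbound
    calc v b ≤ Real.exp (-(P b - P τ)) * v τ :=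
          hflow τ b hτ.1.le hτ.2 hb.2 hτb fun s hs =>
            habove s ⟨hτ.1.trans hs.1, hs.2.trans hb.2⟩
      _ ≤ Real.exp (-(P b - P τ)) * (d * (d ^ k * Real.exp (-(P τ - P a)) * v a)) := by
          gcongr
          exact (hjL hRL).trans (by gcongr)
      _ = d ^ (k + 1) * Real.exp (-(P b - P a)) * v a := by
          rw [show -(P b - P a) = -(P b - P τ) + -(P τ - P a) by ring, Real.exp_add]
          ring

/-- Either the trajectory stays above the level `R` and is controlled by its initial value, or
it is controlled by its value at the last time it is not above `R`. -/
theorem le_transition_or {γ : Set ℝ} (hγ : IsImpulseSeq γ) {v P : ℝ → ℝ} {t0 t d R : ℝ}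
    (hd : 0 ≤ d) (hP : Continuous P) (hR : 0 ≤ R) (ht : t0 ≤ t)
    (hcont : ∀ a b, t0 ≤ a → a ≤ b → b ≤ t → Ioc a b ∩ γ = ∅ → ContinuousOn v (Icc a b))
    (hflow : ∀ a b, t0 ≤ a → a ≤ b → b ≤ t → Ioc a b ∩ γ = ∅ → (∀ s ∈ Ioc a b, R < v s) →
      v b ≤ Real.exp (-(P b - P a)) * v a)
    (hjump : ∀ τ ∈ γ, τ ∈ Ioc t0 t → ∃ L, Tendsto v (nhdsWithin τ (Iio τ)) (nhds L) ∧
      (R ≤ L → v τ ≤ d * L) ∧ (v τ ≤ d * L ∨ v τ ≤ R)) :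
    v t ≤ d ^ nJumps γ t0 t * Real.exp (-(P t - P t0)) * v t0 ∨
      ∃ s ∈ Icc t0 t,
        v t ≤ d ^ nJumps γ s t * Real.exp (-(P t - P s)) * (max d 1 * R) := by
  have key : ∀ a ∈ Icc t0 t, (∀ s ∈ Ioc a t, R < v s) →
      v t ≤ d ^ nJumps γ a t * Real.exp (-(P t - P a)) * v a := fun a ha habove =>
    le_transition_of_lt hγ hd hP (fun r b har => hflow r b (ha.1.trans har))
      (fun τ hτγ hτ => by
        obtain ⟨L, h1, h2, -⟩ := hjump τ hτγ ⟨ha.1.trans_lt hτ.1, hτ.2⟩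
        exact ⟨L, h1, h2⟩)
      habove _ t ⟨ha.2, le_rfl⟩ rfl
  let S : Set ℝ := {s | s ∈ Icc t0 t ∧ v s ≤ R}
  rcases S.eq_empty_or_nonempty with hS | hS
  · left
    refine key t0 ⟨le_rfl, ht⟩ fun s hs => ?_
    by_contra hcon
    exact (hS ▸ notMem_empty s : s ∉ S) ⟨⟨hs.1.le, hs.2⟩, not_lt.1 hcon⟩
  right
  have hbdd : BddAbove S := ⟨t, fun s hs => hs.1.2⟩
  have hle : ∀ s ∈ S, s ≤ sSup S := fun s hs => le_csSup hbdd hs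
  have hmem : sSup S ∈ Icc t0 t := by
    obtain ⟨s, hs⟩ := hS
    exact ⟨hs.1.1.trans (hle s hs), csSup_le ⟨s, hs⟩ fun r hr => hr.1.2⟩
  refine ⟨sSup S, hmem, (key _ hmem fun s hs => ?_).trans ?_⟩
  · by_contra hcon
    exact absurd (hle s ⟨⟨hmem.1.trans hs.1.le, hs.2⟩, not_lt.1 hcon⟩) (not_le.2 hs.1)
  gcongr
  have h1R : R ≤ max d 1 * R := le_mul_of_one_le_left hR (le_max_right _ _)
  by_cases hsS : sSup S ∈ S
  · exact hsS.2.trans h1R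
  have hlim : ∀ L, Tendsto v (nhdsWithin (sSup S) (Iio (sSup S))) (nhds L) → L ≤ R := by
    intro L hL
    by_contra hcon
    obtain ⟨l, hl, hlS⟩ := mem_nhdsLT_iff_exists_Ioo_subset.1
      (hL.eventually (eventually_gt_nhds (not_le.1 hcon)))
    obtain ⟨s, hs, hls⟩ := exists_lt_of_lt_csSup hS hl
    have hne : s ≠ sSup S := fun h => hsS (h ▸ hs)
    exact absurd hs.2 (not_le.2 (hlS ⟨hls, lt_of_le_of_ne (hle s hs) hne⟩))
  have hlt : t0 < sSup S := by
    obtain ⟨s, hs⟩ := hS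
    have hne : s ≠ sSup S := fun h => hsS (h ▸ hs)
    exact hs.1.1.trans_lt (lt_of_le_of_ne (hle s hs) hne)
  by_cases hγS : sSup S ∈ γ
  · obtain ⟨L, hL, -, h | h⟩ := hjump _ hγS ⟨hlt, hmem.2⟩
    · calc v (sSup S) ≤ d * L := h
        _ ≤ d * R := by gcongr; exact hlim L hL
        _ ≤ max d 1 * R := by gcongr; exact le_max_left _ _
    · exact h.trans h1R
  · refine (hlim _ ?_).trans h1R
    obtain ⟨ε, hε, hiso⟩ := hγ.exists_isolating (sSup S)
    have ha : max t0 (sSup S - ε / 2) < sSup S := max_lt hlt (by linarith)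
    have hc := hcont (max t0 (sSup S - ε / 2)) (sSup S) (le_max_left _ _) ha.le hmem.2 (by
      by_contra hcon
      obtain ⟨s, hs, hsγ⟩ := nonempty_iff_ne_empty.2 hcon
      have h1 := (le_max_right t0 _).trans_lt hs.1
      have := hiso s hsγ (abs_lt.2 ⟨by linarith, by linarith [hs.2]⟩)
      exact hγS (this ▸ hsγ))
    have hcw := (hc (sSup S) ⟨ha.le, le_rfl⟩).tendsto
    exact hcw.mono_left (by
      rw [← nhdsWithin_Ioo_eq_nhdsLT ha]
      exact nhdsWithin_mono _ Ioo_subset_Icc_self)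

theorem AbsolutelyContinuousOnInterval.of_dist_le {X Y : Type*} [PseudoMetricSpace X]
    [PseudoMetricSpace Y] {F : ℝ → X} {G : ℝ → Y} {a b C : ℝ}
    (hG : AbsolutelyContinuousOnInterval G a b)
    (h : ∀ s ∈ uIcc a b, ∀ t ∈ uIcc a b, dist (F s) (F t) ≤ C * dist (G s) (G t)) :
    AbsolutelyContinuousOnInterval F a b := by
  have hlim := Tendsto.const_mul C hG
  rw [mul_zero] at hlim
  refine squeeze_zero' (Eventually.of_forall fun E => Finset.sum_nonneg fun _ _ => dist_nonneg)
    ?_ hlim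
  refine eventually_inf_principal.2 (Eventually.of_forall fun E hE => ?_)
  rw [Finset.mul_sum]
  exact Finset.sum_le_sum fun i hi => h _ (hE.1 i hi).1 _ (hE.1 i hi).2

theorem AbsolutelyContinuousOnInterval.comp_locallyLipschitzOn {X Y : Type*}
    [SeminormedAddCommGroup X] [PseudoMetricSpace Y] {F : X → Y} {G : ℝ → X} {a b : ℝ}
    (hG : AbsolutelyContinuousOnInterval G a b) (hF : LocallyLipschitzOn (G '' uIcc a b) F) :
    AbsolutelyContinuousOnInterval (fun s => F (G s)) a b := by
  have hGc : IsCompact (G '' uIcc a b) := isCompact_uIcc.image_of_continuousOn hG.continuousOn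
  obtain ⟨K, hK⟩ := hF.exists_lipschitzOnWith_of_compact hGc
  exact hG.of_dist_le fun s hs t ht =>
    hK.dist_le_mul _ (mem_image_of_mem G hs) _ (mem_image_of_mem G ht)

theorem AbsolutelyContinuousOnInterval.exp {G : ℝ → ℝ} {a b : ℝ}
    (hG : AbsolutelyContinuousOnInterval G a b) :
    AbsolutelyContinuousOnInterval (fun s => Real.exp (G s)) a b :=
  hG.comp_locallyLipschitzOn ((Real.contDiff_exp (n := 1)).locallyLipschitz.locallyLipschitzOn)

/-- The graph `s ↦ (s, x s)` of an indefinite integral is absolutely continuous. -/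
theorem absolutelyContinuousOnInterval_graph {E : Type*} [NormedAddCommGroup E]
    [NormedSpace ℝ E] {x F : ℝ → E} {a b : ℝ} (hab : a ≤ b)
    (hF : IntervalIntegrable F volume a b)
    (hx : ∀ s ∈ Icc a b, x s = x a + ∫ r in a..s, F r) :
    AbsolutelyContinuousOnInterval (fun s => (s, x s)) a b := by
  have hintegral : ∀ s ∈ Icc a b, ∀ t ∈ Icc a b, IntervalIntegrable F volume s t :=
    fun s hs t ht => hF.mono_set (by
      rw [uIcc_of_le hab]
      exact uIcc_subset_Icc hs ht)
  have ha : a ∈ Icc a b := ⟨le_rfl, hab⟩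
  have hid : AbsolutelyContinuousOnInterval (fun s : ℝ => s) a b :=
    (LipschitzWith.id.lipschitzOnWith).absolutelyContinuousOnInterval
  have hG := hid.fun_add (hF.norm.absolutelyContinuousOnInterval_intervalIntegral
    (left_mem_uIcc : a ∈ uIcc a b))
  have hle : ∀ s ∈ Icc a b, ∀ t ∈ Icc a b, s ≤ t → dist (s, x s) (t, x t) ≤
      1 * dist (s + ∫ r in a..s, ‖F r‖) (t + ∫ r in a..t, ‖F r‖) := by
    intro s hs t ht hst
    have h1 : x t - x s = ∫ r in s..t, F r := by
      rw [hx s hs, hx t ht, add_sub_add_left_eq_sub,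
        intervalIntegral.integral_interval_sub_left (hintegral _ ha _ ht) (hintegral _ ha _ hs)]
    have h2 : ‖x t - x s‖ ≤ ∫ r in s..t, ‖F r‖ := by
      rw [h1]
      exact intervalIntegral.norm_integral_le_integral_norm hst
    have h3 : (∫ r in a..t, ‖F r‖) - ∫ r in a..s, ‖F r‖ = ∫ r in s..t, ‖F r‖ :=
      intervalIntegral.integral_interval_sub_left (hintegral _ ha _ ht).norm (hintegral _ ha _ hs).norm
    have h4 : 0 ≤ ∫ r in s..t, ‖F r‖ := (norm_nonneg _).trans h2
    rw [one_mul, dist_comm (s, x s), dist_comm _ (t + _), Prod.dist_eq,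
      Real.dist_eq, Real.dist_eq, dist_eq_norm]
    simp only
    rw [abs_of_nonneg (sub_nonneg.2 hst), abs_of_nonneg (by linarith)]
    exact max_le (by linarith) (by linarith)
  refine hG.of_dist_le (C := 1) ?_
  rw [uIcc_of_le hab]
  intro s hs t ht
  rcases le_total s t with h | h
  · exact hle s hs t ht h
  · rw [dist_comm (s, x s), dist_comm (s + _)]
    exact hle t ht s hs h

theorem LocIntegrable.intervalIntegrable {p : ℝ → ℝ} (hp : LocIntegrable p) (a b : ℝ) :
    IntervalIntegrable p volume a b :=
  (intervalIntegrable_iff_integrableOn_Icc_of_le min_le_max |>.2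
    (hp (min a b) (max a b))).mono_set (by rw [uIcc_of_le min_le_max, uIcc])

theorem LocIntegrable.ae_hasDerivAt {p : ℝ → ℝ} (hp : LocIntegrable p) :
    ∀ᵐ s, HasDerivAt (fun t => ∫ r in (0 : ℝ)..t, p r) (p s) s := by
  have hloc : LocallyIntegrable p volume := fun s =>
    ⟨Icc (s - 1) (s + 1), Icc_mem_nhds (by linarith) (by linarith), hp _ _⟩
  filter_upwards [LocallyIntegrable.ae_hasDerivAt_integral hloc] with s hs using hs 0

theorem LocIntegrable.absolutelyContinuousOnInterval {p : ℝ → ℝ} (hp : LocIntegrable p)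
    (a b : ℝ) : AbsolutelyContinuousOnInterval (fun t => ∫ r in (0 : ℝ)..t, p r) a b := by
  have h := (hp.intervalIntegrable (min 0 (min a b)) (max 0 (max a b))
    ).absolutelyContinuousOnInterval_intervalIntegral (c := 0)
    (mem_uIcc.2 (Or.inl ⟨min_le_left _ _, le_max_left _ _⟩))
  exact h.mono (uIcc_subset_uIcc
    (mem_uIcc.2 (Or.inl ⟨by simp, by simp⟩)) (mem_uIcc.2 (Or.inl ⟨by simp, by simp⟩)))

theorem LocIntegrable.isLinSol_exp {p : ℝ → ℝ} (hp : LocIntegrable p) :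
    IsLinSol p fun t => Real.exp (-∫ r in (0 : ℝ)..t, p r) := by
  intro t1 t2 _ _
  have hac := ((hp.absolutelyContinuousOnInterval t1 t2).fun_neg).exp
  refine ⟨(hp.intervalIntegrable t1 t2).mul_continuousOn hac.continuousOn, ?_⟩
  have hintegral := hac.integral_deriv_eq_sub
  have hcongr : ∫ s in t1..t2, deriv (fun t => Real.exp (-∫ r in (0 : ℝ)..t, p r)) s =
      ∫ s in t1..t2, -(p s * Real.exp (-∫ r in (0 : ℝ)..s, p r)) := by
    refine intervalIntegral.integral_congr_ae ?_
    filter_upwards [hp.ae_hasDerivAt] with s hs _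
    rw [hs.fun_neg.exp.deriv]
    ring
  rw [← hcongr, hintegral]
  ring

theorem le_exp_mul_of_ae_deriv_le {v P p : ℝ → ℝ} {a b : ℝ} (hab : a ≤ b)
    (hv : AbsolutelyContinuousOnInterval v a b) (hP : AbsolutelyContinuousOnInterval P a b)
    (hderivP : ∀ᵐ s, HasDerivAt P (p s) s)
    (hderiv : ∀ᵐ s, s ∈ Ioo a b → deriv v s ≤ -(p s * v s)) :
    v b ≤ Real.exp (-(P b - P a)) * v a := by
  have hy := hv.fun_mul hP.exp
  have hintegral := hy.integral_deriv_eq_sub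
  have hle : ∫ s in a..b, deriv (fun s => v s * Real.exp (P s)) s ≤ 0 := by
    rw [intervalIntegral.integral_of_le hab, integral_Ioc_eq_integral_Ioo]
    refine setIntegral_nonpos_of_ae_restrict ((ae_restrict_iff' measurableSet_Ioo).2 ?_)
    filter_upwards [hderivP, hderiv, hv.ae_differentiableAt] with s hPs hvs hds hs
    have hd := (hds (by rw [uIcc_of_le hab]; exact Ioo_subset_Icc_self hs)).hasDerivAt
    rw [(hd.fun_mul hPs.exp).deriv, Pi.zero_apply]
    nlinarith [Real.exp_pos (P s), hvs hs]
  have h1 : v b * Real.exp (P b) ≤ v a * Real.exp (P a) := by linarith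
  have h2 : Real.exp (-(P b - P a)) = Real.exp (P a) * (Real.exp (P b))⁻¹ := by
    rw [← Real.exp_neg, ← Real.exp_add]
    ring_nf
  rw [h2, mul_right_comm, mul_comm (Real.exp (P a)), ← div_eq_mul_inv,
    le_div_iff₀ (Real.exp_pos _)]
  exact h1

theorem diniAlong_eq_of_hasDerivAt {n m : ℕ} {f : ℝ → Stt n → Stt m → Stt n}
    {V : ℝ → Stt n → ℝ} {x : ℝ → Stt n} {s v' : ℝ} {w : Stt m}
    (hV : ∃ K : NNReal, ∃ t ∈ nhds (s, x s), LipschitzOnWith K (fun q : ℝ × Stt n => V q.1 q.2) t)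
    (hx : HasDerivAt x (f s (x s) w) s) (hv : HasDerivAt (fun r => V r (x r)) v' s) :
    DiniAlong f V s (x s) w = v' := by
  obtain ⟨K, N, hN, hK⟩ := hV
  refine Tendsto.limsup_eq ?_
  set y := f s (x s) w
  have hv1 : Tendsto (fun d : ℝ => (V (s + d) (x (s + d)) - V s (x s)) / d)
      (nhdsWithin 0 (Ioi 0)) (nhds v') := by
    have := hasDerivAt_iff_tendsto_slope_zero.1 hv
    refine (this.mono_left (nhdsWithin_mono _ fun r hr => ne_of_gt hr)).congr fun d => ?_
    simp [div_eq_inv_mul]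
  have hx1 : Tendsto (fun d : ℝ => ‖d⁻¹ • (x (s + d) - x s) - y‖)
      (nhdsWithin 0 (Ioi 0)) (nhds 0) := by
    have := hasDerivAt_iff_tendsto_slope_zero.1 hx
    have h2 := (this.mono_left (nhdsWithin_mono _ fun r hr => ne_of_gt hr) :
      Tendsto _ (nhdsWithin 0 (Ioi (0 : ℝ))) _)
    simpa using (h2.sub_const y).norm
  have hnear1 : ∀ᶠ d in nhdsWithin (0 : ℝ) (Ioi 0), (s + d, x (s + d)) ∈ N := by
    have hc : ContinuousAt (fun d : ℝ => (s + d, x (s + d))) 0 := by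
      have hx' : ContinuousAt x (s + 0) := by simpa using hx.continuousAt
      exact (by fun_prop : ContinuousAt (fun d : ℝ => s + d) 0).prodMk
        (hx'.comp (f := fun d : ℝ => s + d) (by fun_prop))
    have := hc.tendsto
    simp only [add_zero] at this
    exact nhdsWithin_le_nhds (this.eventually hN)
  have hnear2 : ∀ᶠ d in nhdsWithin (0 : ℝ) (Ioi 0), (s + d, x s + d • y) ∈ N := by
    have hc : Continuous fun d : ℝ => (s + d, x s + d • y) := by fun_prop
    have := hc.tendsto 0
    simp only [add_zero, zero_smul] at this
    exact nhdsWithin_le_nhds (this.eventually hN)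
  have hdiff : Tendsto (fun d : ℝ => (V (s + d) (x s + d • y) - V (s + d) (x (s + d))) / d)
      (nhdsWithin 0 (Ioi 0)) (nhds 0) := by
    refine squeeze_zero_norm' (a := fun d => K * ‖d⁻¹ • (x (s + d) - x s) - y‖) ?_ ?_
    · filter_upwards [hnear1, hnear2, self_mem_nhdsWithin] with d h1 h2 hd
      have hd : 0 < d := hd
      have h3 := hK.dist_le_mul _ h2 _ h1
      have h4 : dist (s + d, x s + d • y) (s + d, x (s + d)) =
          d * ‖d⁻¹ • (x (s + d) - x s) - y‖ := by
        rw [Prod.dist_eq, dist_self, max_eq_right dist_nonneg, dist_comm, dist_eq_norm]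
        have h5 : d * ‖d⁻¹ • (x (s + d) - x s) - y‖ = ‖d • (d⁻¹ • (x (s + d) - x s) - y)‖ := by
          rw [norm_smul, Real.norm_eq_abs, abs_of_pos hd]
        rw [h5, smul_sub, smul_inv_smul₀ hd.ne', sub_sub]
      rw [h4, Real.dist_eq] at h3
      rw [norm_div, Real.norm_eq_abs, Real.norm_eq_abs, abs_of_pos hd, div_le_iff₀ hd]
      linarith
    · simpa using hx1.const_mul (K : ℝ)
  have := hdiff.add hv1
  rw [zero_add] at this
  refine this.congr fun d => ?_
  rw [← add_div]
  congr 1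
  ring

section Solution

variable {n m : ℕ} {γ : Set ℝ} {f g : ℝ → Stt n → Stt m → Stt n} {t0 : ℝ} {x0 : Stt n}
  {u : ℝ → Stt m} {T : EReal} {x : ℝ → Stt n} {V Vm : ℝ → Stt n → ℝ} {a b : ℝ}

theorem IsImpulseSeq.exists_gt_Ioo_inter_eq_empty (hγ : IsImpulseSeq γ)
    (hempty : Ioc a b ∩ γ = ∅) : ∃ b' > b, Ioo a b' ∩ γ = ∅ := by
  obtain ⟨ε, hε, hiso⟩ := hγ.exists_isolating b
  refine ⟨b + ε, by linarith, ?_⟩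
  by_contra hcon
  obtain ⟨s, hs, hsγ⟩ := nonempty_iff_ne_empty.2 hcon
  rcases le_or_gt s b with hsb | hsb
  · exact (hempty ▸ (⟨⟨hs.1, hsb⟩, hsγ⟩ : s ∈ Ioc a b ∩ γ) : s ∈ (∅ : Set ℝ))
  · exact hsb.ne' (hiso s hsγ (abs_lt.2 ⟨by linarith, by linarith [hs.2]⟩))

theorem IsSolution.intervalIntegrable (hsol : IsSolution γ f g t0 x0 u T x) (ha : t0 ≤ a)
    (hab : a ≤ b) (hb : (b : EReal) < T) (hempty : Ioc a b ∩ γ = ∅) :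
    IntervalIntegrable (fun s => f s (x s) (u s)) volume a b :=
  (intervalIntegrable_iff_integrableOn_Icc_of_le hab).2 (hsol.flow a b ha hab hb hempty).1

theorem IsSolution.eq_add_integral (hsol : IsSolution γ f g t0 x0 u T x) (ha : t0 ≤ a)
    (hb : (b : EReal) < T) (hempty : Ioc a b ∩ γ = ∅) :
    ∀ s ∈ Icc a b, x s = x a + ∫ r in a..s, f r (x r) (u r) := fun s hs =>
  (hsol.flow a s ha hs.1 ((EReal.coe_le_coe_iff.2 hs.2).trans_lt hb)
    (subset_empty_iff.1 (hempty ▸ inter_subset_inter_left γ (Ioc_subset_Ioc_right hs.2)))).2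

theorem IsSolution.absolutelyContinuousOnInterval (hsol : IsSolution γ f g t0 x0 u T x)
    (hγ : IsImpulseSeq γ) (hV : InClassV γ V Vm) (ht0 : 0 ≤ t0) (ha : t0 ≤ a)
    (hab : a ≤ b) (hb : (b : EReal) < T) (hempty : Ioc a b ∩ γ = ∅) :
    AbsolutelyContinuousOnInterval (fun s => V s (x s)) a b := by
  obtain ⟨b', hb', hempty'⟩ := hγ.exists_gt_Ioo_inter_eq_empty hempty
  have hloc : LocallyLipschitzOn (Ico a b' ×ˢ (univ : Set (Stt n)))
      (fun q : ℝ × Stt n => V q.1 q.2) := fun q hq =>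
    hV.1 a b' (ht0.trans ha) hempty' q hq
  refine (absolutelyContinuousOnInterval_graph hab (hsol.intervalIntegrable ha hab hb hempty)
    (hsol.eq_add_integral ha hb hempty)).comp_locallyLipschitzOn
      (F := fun q : ℝ × Stt n => V q.1 q.2) (hloc.mono ?_)
  rintro _ ⟨s, hs, rfl⟩
  rw [uIcc_of_le hab] at hs
  exact ⟨⟨hs.1, hs.2.trans_lt hb'⟩, mem_univ _⟩

theorem IsSolution.ae_hasDerivAt (hsol : IsSolution γ f g t0 x0 u T x) (ha : t0 ≤ a)
    (hab : a ≤ b) (hb : (b : EReal) < T) (hempty : Ioc a b ∩ γ = ∅) :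
    ∀ᵐ s, s ∈ Ioo a b → HasDerivAt x (f s (x s) (u s)) s := by
  filter_upwards [(hsol.intervalIntegrable ha hab hb hempty).ae_hasDerivAt_integral] with s hs hsab
  have h1 := hs (by rw [uIcc_of_le hab]; exact Ioo_subset_Icc_self hsab) a left_mem_uIcc
  refine (h1.const_add (x a)).congr_of_eventuallyEq ?_
  filter_upwards [Ioo_mem_nhds hsab.1 hsab.2] with r hr
  exact hsol.eq_add_integral ha hb hempty r (Ioo_subset_Icc_self hr)

/-- Exponential estimate for `V` along a solution on an interval free of impulses. -/
theorem IsSolution.le_exp_mul (hsol : IsSolution γ f g t0 x0 u T x)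
    (hγ : IsImpulseSeq γ) (hV : InClassV γ V Vm) (ht0 : 0 ≤ t0) (ha : t0 ≤ a)
    (hab : a ≤ b) (hb : (b : EReal) < T) (hempty : Ioc a b ∩ γ = ∅)
    {p : ℝ → ℝ} (hp : LocIntegrable p)
    (hdini : ∀ᵐ s, s ∈ Ioo a b → DiniAlong f V s (x s) (u s) ≤ -(p s * V s (x s))) :
    V b (x b) ≤ Real.exp (-((∫ r in (0 : ℝ)..b, p r) - ∫ r in (0 : ℝ)..a, p r)) * V a (x a) := by
  have hac := hsol.absolutelyContinuousOnInterval hγ hV ht0 ha hab hb hempty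
  refine le_exp_mul_of_ae_deriv_le (v := fun s => V s (x s))
    (P := fun t => ∫ r in (0 : ℝ)..t, p r) hab hac
    (hp.absolutelyContinuousOnInterval a b) hp.ae_hasDerivAt ?_
  filter_upwards [hac.ae_differentiableAt, hsol.ae_hasDerivAt ha hab hb hempty, hdini]
    with s hs1 hs2 hs3 hs
  have hd := (hs1 (by rw [uIcc_of_le hab]; exact Ioo_subset_Icc_self hs)).hasDerivAt
  have hsγ : Ioo a b ∩ γ = ∅ :=
    subset_empty_iff.1 (hempty ▸ inter_subset_inter_left γ Ioo_subset_Ioc_self)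
  obtain ⟨K, N, hN, hK⟩ := hV.1 a b (ht0.trans ha) hsγ (s, x s)
    ⟨Ioo_subset_Ico_self hs, mem_univ _⟩
  rw [nhdsWithin_eq_nhds.2 (prod_mem_nhds (Ico_mem_nhds hs.1 hs.2) univ_mem)] at hN
  rw [← diniAlong_eq_of_hasDerivAt ⟨K, N, hN, hK⟩ (hs2 hs) hd]
  exact hs3 hs

theorem InClassV.tendsto_left (hV : InClassV γ V Vm) {τ : ℝ} (hτ : τ ∈ γ) {L : Stt n}
    (hx : Tendsto x (nhdsWithin τ (Iio τ)) (nhds L)) :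
    Tendsto (fun s => V s (x s)) (nhdsWithin τ (Iio τ)) (nhds (Vm τ L)) := by
  refine (hV.2 τ hτ L).comp (f := fun s => (s, x s)) (tendsto_nhdsWithin_iff.2 ⟨?_, ?_⟩)
  · exact (tendsto_nhdsWithin_of_tendsto_nhds tendsto_id).prodMk_nhds hx
  · filter_upwards [self_mem_nhdsWithin] with s hs using ⟨hs, mem_univ _⟩

end Solution

section InputNorm

variable {m : ℕ} {γ : Set ℝ} {u : ℝ → Stt m} {a b : ℝ}

theorem inputNorm_nonneg : 0 ≤ inputNorm γ u (Ioc a b) :=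
  (Real.sSup_nonneg (by rintro _ ⟨s, _, rfl⟩; exact norm_nonneg _)).trans (le_max_right _ _)

theorem norm_le_inputNorm (hγ : IsImpulseSeq γ) {τ : ℝ} (hτγ : τ ∈ γ) (hτ : τ ∈ Ioc a b) :
    ‖u τ‖ ≤ inputNorm γ u (Ioc a b) := by
  have hmem : τ ∈ γ ∩ Ioc a b := ⟨hτγ, hτ⟩
  refine le_trans (le_csSup ?_ (mem_image_of_mem (fun t => ‖u t‖) hmem)) (le_max_right _ _)
  exact (((hγ.2 b).subset (inter_subset_inter_right γ fun s hs => hs.2)).image _).bddAbove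

theorem IsInput.ae_norm_le_inputNorm (hu : IsInput u) (γ : Set ℝ) (ha : 0 ≤ a) :
    ∀ᵐ s, s ∈ Ioc a b → ‖u s‖ ≤ inputNorm γ u (Ioc a b) := by
  obtain ⟨C, hC⟩ := hu.2 b
  have hbdd : IsBoundedUnder (· ≤ ·) (ae (volume.restrict (Ioc a b))) fun s => ‖u s‖ :=
    ⟨C, eventually_map.2 ((ae_restrict_iff' measurableSet_Ioc).2
      (hC.mono fun s hs hsI => hs ⟨ha.trans hsI.1.le, hsI.2⟩))⟩
  refine (ae_restrict_iff' measurableSet_Ioc).1 ?_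
  filter_upwards [ae_le_essSup hbdd] with s hs using hs.trans (le_max_left _ _)

end InputNorm

/-- The jump-rate condition turns the bound on the flow into a bound on the flow with jumps. -/
theorem pow_nJumps_mul_exp_le {γ : Set ℝ} {s t d κ c η μ E : ℝ} (hd : 0 ≤ d)
    (hκ : 0 < κ) (hE : E ≤ κ * Real.exp (-(c * (t - s))))
    (hcond : (0 < d ∨ nJumps γ s t = 0) →
      (nJumps γ s t : ℝ) * (Real.log d + η) - (c - η) * (t - s) ≤ μ) :
    d ^ nJumps γ s t * E ≤
      κ * Real.exp μ * Real.exp (-(η * (t - s + (nJumps γ s t : ℝ)))) := by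
  rcases em (0 < d ∨ nJumps γ s t = 0) with hcase | hcase
  · have hpow : d ^ nJumps γ s t = Real.exp (nJumps γ s t * Real.log d) := by
      rcases hcase with hd' | h0
      · rw [Real.exp_nat_mul, Real.exp_log hd']
      · simp [h0]
    calc d ^ nJumps γ s t * E
        ≤ Real.exp (nJumps γ s t * Real.log d) * (κ * Real.exp (-(c * (t - s)))) := by
          rw [hpow]; gcongr
      _ = κ * Real.exp (nJumps γ s t * Real.log d + -(c * (t - s))) := by
          rw [Real.exp_add]; ring
      _ ≤ κ * Real.exp (μ + -(η * (t - s + (nJumps γ s t : ℝ)))) := by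
          have := hcond hcase
          refine mul_le_mul_of_nonneg_left (Real.exp_le_exp.2 ?_) hκ.le
          linarith
      _ = _ := by rw [Real.exp_add]; ring
  · obtain ⟨h1, h2⟩ := not_or.1 hcase
    rw [le_antisymm (not_lt.1 h1) hd, zero_pow h2, zero_mul]
    positivity

/-- Theorem 3(b): strong `(h⁰,h)`-ISS under the jump-rate condition (11). -/
theorem stmt5 {n m : ℕ} {Λ : Type*} (γ : Λ → Set ℝ)
    (f g : Λ → ℝ → Stt n → Stt m → Stt n)
    (hγ : ∀ l : Λ, IsImpulseSeq (γ l))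
    (h0 h : ℝ → Stt n → ℝ)
    (hh0 : ∀ (t : ℝ) (ξ : Stt n), 0 ≤ t → 0 ≤ h0 t ξ)
    (hh : ∀ (t : ℝ) (ξ : Stt n), 0 ≤ t → 0 ≤ h t ξ)
    (V Vm : Λ → ℝ → Stt n → ℝ) (φ1 φ2 χ π : ℝ → ℝ)
    (p : Λ → ℝ → ℝ) (d : ℝ) (hd : 0 ≤ d)
    (hpmeas : ∀ l : Λ, Measurable (p l)) (hploc : ∀ l : Λ, LocIntegrable (p l))
    (hA1 : Assumption1 γ f g h0 h V Vm φ1 φ2 χ π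
      (fun l t r => p l t * r) (fun _ _ r => d * r))
    (κ c : ℝ) (hκ : 0 < κ)
    (hlin : ∀ (l : Λ) (w : ℝ → ℝ), IsLinSol (p l) w →
      ∀ t0 t : ℝ, 0 ≤ t0 → t0 ≤ t → |w t| ≤ κ * Real.exp (-(c * (t - t0))) * |w t0|)
    (η μ : ℝ) (hη : 0 < η) (hμ : 0 < μ)
    (hcond : ∀ (l : Λ) (t0 t : ℝ), 0 ≤ t0 → t0 ≤ t →
      (0 < d ∨ nJumps (γ l) t0 t = 0) →
      (nJumps (γ l) t0 t : ℝ) * (Real.log d + η) - (c - η) * (t - t0) ≤ μ) :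
    StronglyISS γ f g h0 h := by

  obtain ⟨hφ1, hφ2, hχ, hπ, hV, -, -, hsand, hdini, hj1, hj2⟩ := hA1
  obtain ⟨ψ, hψ, hψφ⟩ := hφ1.exists_leftInverse
  set M := κ * Real.exp μ
  have hM0 : 0 < M := by positivity
  have hD0 : 0 < max d 1 := lt_max_of_lt_right one_pos
  refine ⟨fun r s => ψ (2 * M * Real.exp (-(η * s)) * φ2 r),
    fun r => ψ (2 * M * max d 1 * (χ r + π r)),
    classKL_exp_decay hψ hφ2 (by positivity) hη,
    hψ.comp ((hχ.add hπ).const_mul (by positivity)), ?_⟩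
  intro l t0 x0 u T x ht0 hu hmax t ht htT
  have hsol := hmax.1
  have hb : ∀ b, b ≤ t → (b : EReal) < T := fun b hb =>
    (EReal.coe_le_coe_iff.2 hb).trans_lt htT
  set U := inputNorm (γ l) u (Ioc t0 t)
  have hU : 0 ≤ U := inputNorm_nonneg
  have hR : 0 ≤ χ U + π U := add_nonneg (hχ.nonneg hU) (hπ.nonneg hU)
  have htrans : ∀ s ∈ Icc t0 t, d ^ nJumps (γ l) s t *
      Real.exp (-((∫ r in (0 : ℝ)..t, p l r) - ∫ r in (0 : ℝ)..s, p l r)) ≤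
      M * Real.exp (-(η * (t - s + (nJumps (γ l) s t : ℝ)))) := by
    intro s hs
    refine pow_nJumps_mul_exp_le hd hκ ?_ (hcond l s t (ht0.trans hs.1) hs.2)
    have h1 := hlin l _ (hploc l).isLinSol_exp s t (ht0.trans hs.1) hs.2
    rw [Real.abs_exp, Real.abs_exp] at h1
    rw [neg_sub, sub_eq_add_neg, add_comm, Real.exp_add]
    calc _ ≤ κ * Real.exp (-(c * (t - s))) * Real.exp (-∫ r in (0 : ℝ)..s, p l r) *
          Real.exp (∫ r in (0 : ℝ)..s, p l r) := by gcongr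
      _ = _ := by rw [mul_assoc, ← Real.exp_add, neg_add_cancel, Real.exp_zero, mul_one]
  have hbound : V l t (x t) ≤ M * Real.exp (-(η * (t - t0 + (nJumps (γ l) t0 t : ℝ)))) *
      φ2 (h0 t0 x0) + M * max d 1 * (χ U + π U) := by
    have hφ0 : 0 ≤ φ2 (h0 t0 x0) := hφ2.nonneg (hh0 _ _ ht0)
    have hV0 : V l t0 (x t0) ≤ φ2 (h0 t0 x0) := hsol.init ▸ (hsand l t0 x0 ht0).2
    have hor := le_transition_or (hγ l) (v := fun s => V l s (x s))
      (P := fun t => ∫ r in (0 : ℝ)..t, p l r) hd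
      (intervalIntegral.continuous_primitive (hploc l).intervalIntegrable 0) hR ht
      (fun a b ha hab hbt hempty => by
        have := (hsol.absolutelyContinuousOnInterval (hγ l) (hV l) ht0 ha hab (hb b hbt)
          hempty).continuousOn
        rwa [uIcc_of_le hab] at this)
      (fun a b ha hab hbt hempty habove => by
        refine hsol.le_exp_mul (hγ l) (hV l) ht0 ha hab (hb b hbt) hempty (hploc l) ?_
        filter_upwards [hu.ae_norm_le_inputNorm (b := t) (γ l) ht0] with s hs hsab
        have hsI : s ∈ Ioc t0 t := ⟨ha.trans_lt hsab.1, hsab.2.le.trans hbt⟩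
        refine hdini l s (x s) (u s) (ht0.trans hsI.1.le) (fun hsγ => ?_) ?_
        · exact (hempty ▸ (⟨Ioo_subset_Ioc_self hsab, hsγ⟩ : s ∈ Ioc a b ∩ γ l) :
            s ∈ (∅ : Set ℝ))
        · linarith [hχ.mono (norm_nonneg _) (hs hsI), hπ.nonneg hU,
            habove s (Ioo_subset_Ioc_self hsab)])
      (fun τ hτγ hτ => by
        obtain ⟨L, hL, hxτ⟩ := hsol.jump τ hτγ hτ.1 (hb τ hτ.2)
        have huτ : ‖u τ‖ ≤ U := norm_le_inputNorm (hγ l) hτγ hτ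
        have hχτ := hχ.mono (norm_nonneg _) huτ
        have hπτ := hπ.mono (norm_nonneg _) huτ
        refine ⟨Vm l τ L, (hV l).tendsto_left hτγ hL, fun hRL => ?_, ?_⟩
        · rw [hxτ]
          exact hj1 l τ L (u τ) hτγ (by linarith [hπ.nonneg hU])
        · rw [hxτ]
          rcases le_total (χ ‖u τ‖) (Vm l τ L) with hle | hle
          · exact Or.inl (hj1 l τ L (u τ) hτγ hle)
          · exact Or.inr ((hj2 l τ L (u τ) hτγ hle).trans (by linarith [hχ.nonneg hU])))
    rcases hor with hfirst | ⟨s, hs, hsecond⟩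
    · have h1 := htrans t0 ⟨le_rfl, ht⟩
      calc _ ≤ _ := hfirst
        _ ≤ d ^ nJumps (γ l) t0 t *
            Real.exp (-((∫ r in (0 : ℝ)..t, p l r) - ∫ r in (0 : ℝ)..t0, p l r)) *
            φ2 (h0 t0 x0) := by gcongr
        _ ≤ M * Real.exp (-(η * (t - t0 + (nJumps (γ l) t0 t : ℝ)))) *
            φ2 (h0 t0 x0) := by gcongr
        _ ≤ _ := le_add_of_nonneg_right (by positivity)
    · have h1 : M * Real.exp (-(η * (t - s + (nJumps (γ l) s t : ℝ)))) ≤ M := by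
        refine mul_le_of_le_one_right hM0.le (Real.exp_le_one_iff.2 ?_)
        have := sub_nonneg.2 hs.2
        rw [neg_nonpos]
        positivity
      calc _ ≤ _ := hsecond
        _ ≤ M * (max d 1 * (χ U + π U)) := by
          gcongr
          exact (htrans s hs).trans h1
        _ = M * max d 1 * (χ U + π U) := by ring
        _ ≤ _ := le_add_of_nonneg_left (by positivity)
  have ht' : 0 ≤ t := ht0.trans ht
  have hφ0 : 0 ≤ φ2 (h0 t0 x0) := hφ2.nonneg (hh0 _ _ ht0)
  calc h t (x t) = ψ (φ1 (h t (x t))) := (hψφ _ (hh _ _ ht')).symm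
    _ ≤ ψ (_ + _) := hψ.mono (hφ1.nonneg (hh _ _ ht')) ((hsand l t (x t) ht').1.trans hbound)
    _ ≤ _ := hψ.apply_add_le (by positivity) (by positivity)
    _ = _ := by simp only [mul_assoc]

end
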